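/- For every natural number n ≥ 7, the exceptional Hermite polynomials Ĥ_k := H_k + 4k·H_{k−2} + 4k(k−3)·H_{k−4} satisfy the higher-order recurrence relation 16X²(1 + X²)·Ĥ_n = Ĥ_{n+4} + 8n·Ĥ_{n+2} + 4(6n² − 14n + 1)·Ĥ_n + 32n(n−3)(n−4)·Ĥ_{n−2} + 16n(n−3)(n−5)(n−6)·Ĥ_{n−4} as an identity in ℝ[X]. -/

import Mathlib

open Polynomial

/-- The physicists' Hermite polynomials: `H₀ = 1`, `H_{n+1} = 2·X·H_n − (H_n)'`. -/
noncomputable def hermitePoly : ℕ → Polynomial ℝ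
  | 0 => 1
  | n + 1 => 2 * X * hermitePoly n - derivative (hermitePoly n)

/-- The exceptional Hermite polynomials of codimension 2:
`Ĥ_k = H_k + 4k·H_{k−2} + 4k(k−3)·H_{k−4}`. -/
noncomputable def excHermitePoly (k : ℕ) : Polynomial ℝ :=
  hermitePoly k + C (4 * (k : ℝ)) * hermitePoly (k - 2)
    + C (4 * (k : ℝ) * ((k : ℝ) - 3)) * hermitePoly (k - 4)

theorem derivative_hermitePoly_succ (n : ℕ) :
    derivative (hermitePoly (n + 1)) = C (2 * ((n : ℝ) + 1)) * hermitePoly n := by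
  induction n with
  | zero => simp [hermitePoly, map_ofNat]
  | succ n ih =>
    have h : hermitePoly (n + 1) = 2 * X * hermitePoly n - derivative (hermitePoly n) := rfl
    have h2 : hermitePoly (n + 1 + 1)
        = 2 * X * hermitePoly (n + 1) - derivative (hermitePoly (n + 1)) := rfl
    have hd : derivative (hermitePoly n) = 2 * X * hermitePoly n - hermitePoly (n + 1) := by
      rw [h]; ring
    rw [h2, ih]
    simp only [derivative_sub, derivative_mul, derivative_C, derivative_X, derivative_ofNat, ih,
      hd]
    simp only [map_mul, map_add, map_natCast, map_one, map_ofNat, Nat.cast_add, Nat.cast_one]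
    ring

theorem hermitePoly_add_two (n : ℕ) :
    hermitePoly (n + 2)
      = 2 * X * hermitePoly (n + 1) - 2 * ((n : ℝ[X]) + 1) * hermitePoly n := by
  have h : hermitePoly (n + 2)
      = 2 * X * hermitePoly (n + 1) - derivative (hermitePoly (n + 1)) := rfl
  rw [h, derivative_hermitePoly_succ]
  simp only [map_mul, map_add, map_natCast, map_one, map_ofNat]

theorem excHermitePoly_add_four (k : ℕ) :
    excHermitePoly (k + 4)
      = hermitePoly (k + 4) + C (4 * ((k : ℝ) + 4)) * hermitePoly (k + 2)
        + C (4 * ((k : ℝ) + 4) * ((k : ℝ) + 1)) * hermitePoly k := by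
  have h : (k : ℝ) + 4 - 3 = k + 1 := by ring
  simp only [excHermitePoly, Nat.cast_add, Nat.cast_ofNat, h, Nat.add_sub_cancel,
    show k + 4 - 2 = k + 2 from rfl]

/-- for `n ≥ 7`, the exceptional Hermite polynomials satisfy
`16X²(1 + X²)·Ĥ_n = Ĥ_{n+4} + 8n·Ĥ_{n+2} + 4(6n² − 14n + 1)·Ĥ_n + 32n(n−3)(n−4)·Ĥ_{n−2}
  + 16n(n−3)(n−5)(n−6)·Ĥ_{n−4}`. -/
theorem excHermite_recurrence_order4 (n : ℕ) (hn : 7 ≤ n) :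
    16 * X ^ 2 * (1 + X ^ 2) * excHermitePoly n
      = excHermitePoly (n + 4) + C (8 * (n : ℝ)) * excHermitePoly (n + 2)
        + C (4 * (6 * (n : ℝ) ^ 2 - 14 * (n : ℝ) + 1)) * excHermitePoly n
        + C (32 * (n : ℝ) * ((n : ℝ) - 3) * ((n : ℝ) - 4)) * excHermitePoly (n - 2)
        + C (16 * (n : ℝ) * ((n : ℝ) - 3) * ((n : ℝ) - 5) * ((n : ℝ) - 6)) *
            excHermitePoly (n - 4) := by
  obtain rfl | hn := hn.eq_or_lt
  · have h0 : hermitePoly 0 = 1 := rfl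
    have h1 : hermitePoly 1 = 2 * X := by simp [hermitePoly]
    have r (k : ℕ) := hermitePoly_add_two k
    simp only [excHermitePoly, Nat.reduceAdd, Nat.reduceSub]
    rw [r 9, r 8, r 7, r 6, r 5, r 4, r 3, r 2, r 1, r 0]
    simp only [Nat.reduceAdd, h0, h1]
    simp only [map_mul, map_add, map_sub, map_pow, map_natCast, map_one, map_ofNat]
    push_cast
    ring
  · obtain ⟨m, rfl⟩ : ∃ m, n = m + 8 := ⟨n - 8, by omega⟩
    have e (k : ℕ) : excHermitePoly (m + (k + 4))
        = hermitePoly (m + (k + 4))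
          + C (4 * (((m + k : ℕ) : ℝ) + 4)) * hermitePoly (m + (k + 2))
          + C (4 * (((m + k : ℕ) : ℝ) + 4) * (((m + k : ℕ) : ℝ) + 1)) * hermitePoly (m + k) :=
      excHermitePoly_add_four (m + k)
    have r (k : ℕ) : hermitePoly (m + (k + 2))
        = 2 * X * hermitePoly (m + (k + 1))
          - 2 * (((m + k : ℕ) : ℝ[X]) + 1) * hermitePoly (m + k) :=
      hermitePoly_add_two (m + k)
    rw [show m + 8 - 2 = m + 6 by omega, show m + 8 - 4 = m + 4 by omega,
      show m + 8 + 2 = m + 10 by omega, show m + 8 + 4 = m + 12 by omega,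
      e 8, e 6, e 4, e 2, e 0]
    simp only [Nat.reduceAdd]
    rw [r 10, r 9, r 8, r 7, r 6, r 5, r 4, r 3, r 2, r 1, r 0]
    simp only [map_mul, map_add, map_sub, map_pow, map_natCast, map_one, map_ofNat,
      Nat.cast_add, Nat.cast_ofNat, Nat.cast_one, Nat.reduceAdd, Nat.add_zero]
    ring
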